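/- Let c > 0. For each n, let (U_k) be the urn process with parameters n and p = c/n, and let ν_i = (c/n)·U_{i−1} − (U_{i−1} − U_i) for 1 ≤ i ≤ n be the centered increments. Then for every ε > 0, the probability P( max_{1 ≤ i ≤ n} ν_i² / n ≥ ε ) tends to 0 as n → ∞; i.e., the maximal jump of the rescaled martingale is asymptotically negligible. -/

import Mathlib

open MeasureTheory ProbabilityTheory Filter

/-- The probability that a Binomial(N, p) random variable takes the value `j`. -/
noncomputable def binomialProb (N : ℕ) (p : ℝ) (j : ℕ) : ℝ :=
  (N.choose j : ℝ) * p ^ j * (1 - p) ^ (N - j)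

/-- `U` is an urn process with parameters `n` and `p`: it starts at `n`, is
(pointwise a.s.) nonincreasing, and conditionally on `U 0, …, U k` the decrement
`U k - U (k+1)` has a Binomial(`U k`, `p`) distribution. -/
def IsUrnProcess {Ω : Type*} [MeasurableSpace Ω] (μ : Measure Ω)
    (n : ℕ) (p : ℝ) (U : ℕ → Ω → ℕ)
    (hU : ∀ i, StronglyMeasurable (U i)) : Prop :=
  (∀ᵐ ω ∂μ, U 0 ω = n) ∧
  (∀ k, ∀ᵐ ω ∂μ, U (k + 1) ω ≤ U k ω) ∧
  (∀ k j, μ[Set.indicator {ω | U k ω - U (k + 1) ω = j} (fun _ => (1 : ℝ)) |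
      MeasureTheory.Filtration.natural U hU k]
    =ᵐ[μ] fun ω => binomialProb (U k ω) p j)

open Real in
theorem binomialProb_le_exp {c p : ℝ} {N j : ℕ} (hc : 0 ≤ c) (hp0 : 0 ≤ p) (hp1 : p ≤ 1)
    (hN : N * p ≤ c) : binomialProb N p j ≤ exp (c * exp 1) * exp (-j) := by
  have h1 : binomialProb N p j ≤ (N.choose j : ℝ) * p ^ j :=
    mul_le_of_le_one_right (by positivity) (pow_le_one₀ (by linarith) (by linarith))
  have h2 : (N.choose j : ℝ) * p ^ j ≤ (N : ℝ) ^ j / (j.factorial : ℝ) * p ^ j := by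
    gcongr
    exact Nat.choose_le_pow_div j N
  have h3 : (N : ℝ) ^ j / (j.factorial : ℝ) * p ^ j ≤ c ^ j / j.factorial := by
    rw [div_mul_eq_mul_div, ← mul_pow]
    gcongr
  have h4 : c ^ j / j.factorial = (c * exp 1) ^ j / j.factorial * exp (-j) := by
    rw [mul_pow, ← Real.exp_nat_mul, mul_one, exp_neg]
    field_simp
  have h5 : (c * exp 1) ^ j / j.factorial ≤ exp (c * exp 1) :=
    pow_div_factorial_le_exp _ (by positivity) j
  calc _ ≤ c ^ j / j.factorial := h1.trans (h2.trans h3)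
    _ ≤ _ := by rw [h4]; gcongr

namespace IsUrnProcess

variable {Ω : Type*} [MeasurableSpace Ω] {μ : Measure Ω} {n : ℕ} {p : ℝ} {U : ℕ → Ω → ℕ}
  {hU : ∀ i, StronglyMeasurable (U i)}

theorem ae_le (h : IsUrnProcess μ n p U hU) (k : ℕ) : ∀ᵐ ω ∂μ, U k ω ≤ n := by
  induction k with
  | zero => filter_upwards [h.1] with ω hω using hω.le
  | succ k ih => filter_upwards [ih, h.2.1 k] with ω h1 h2 using h2.trans h1

theorem measure_decrement_eq_le [IsProbabilityMeasure μ] (h : IsUrnProcess μ n p U hU)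
    (hp0 : 0 ≤ p) (hp1 : p ≤ 1) (k j : ℕ) :
    μ {ω | U k ω - U (k + 1) ω = j} ≤
      ENNReal.ofReal (Real.exp (n * p * Real.exp 1) * Real.exp (-j)) := by
  have hmeas : MeasurableSet {ω | U k ω - U (k + 1) ω = j} :=
    ((hU k).measurable.sub (hU (k + 1)).measurable) (measurableSet_singleton j)
  have hle : ∫ ω, (μ[Set.indicator {ω | U k ω - U (k + 1) ω = j} (fun _ => (1 : ℝ)) |
      Filtration.natural U hU k]) ω ∂μ ≤
      ∫ _, Real.exp (n * p * Real.exp 1) * Real.exp (-j) ∂μ := by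
    refine integral_mono_ae integrable_condExp (integrable_const _) ?_
    filter_upwards [h.2.2 k j, h.ae_le k] with ω h1 h2
    rw [h1]
    refine binomialProb_le_exp (by positivity) hp0 hp1 ?_
    gcongr
  rw [integral_condExp ((Filtration.natural U hU).le k), integral_indicator hmeas] at hle
  simp only [integral_const, smul_eq_mul, mul_one, probReal_univ, one_mul,
    measureReal_restrict_apply_univ] at hle
  exact (ENNReal.le_ofReal_iff_toReal_le (measure_ne_top _ _) (by positivity)).2 hle

theorem measure_le_decrement_le [IsProbabilityMeasure μ] (h : IsUrnProcess μ n p U hU)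
    (hp0 : 0 ≤ p) (hp1 : p ≤ 1) (k : ℕ) (x : ℝ) :
    μ {ω | x ≤ (U k ω - U (k + 1) ω : ℕ)} ≤
      ENNReal.ofReal ((n + 1) * (Real.exp (n * p * Real.exp 1) * Real.exp (-x))) := by
  have hsub : {ω | x ≤ (U k ω - U (k + 1) ω : ℕ)} ≤ᵐ[μ]
      ⋃ j ∈ (Finset.range (n + 1)).filter (fun j : ℕ => x ≤ j),
        {ω | U k ω - U (k + 1) ω = j} := by
    filter_upwards [h.ae_le k] with ω h1 h2
    refine Set.mem_biUnion (x := U k ω - U (k + 1) ω) ?_ rfl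
    simp only [Finset.coe_filter, Finset.mem_range, Set.mem_ofPred_eq]
    exact ⟨by omega, h2⟩
  refine (measure_mono_ae hsub).trans <| (measure_biUnion_finset_le _ _).trans ?_
  calc _ ≤ ∑ j ∈ (Finset.range (n + 1)).filter (fun j : ℕ => x ≤ j),
        ENNReal.ofReal (Real.exp (n * p * Real.exp 1) * Real.exp (-x)) := by
        refine Finset.sum_le_sum fun j hj => (h.measure_decrement_eq_le hp0 hp1 k j).trans ?_
        have := (Finset.mem_filter.1 hj).2
        gcongr
    _ ≤ ∑ j ∈ Finset.range (n + 1),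
        ENNReal.ofReal (Real.exp (n * p * Real.exp 1) * Real.exp (-x)) :=
        Finset.sum_le_sum_of_subset (Finset.filter_subset _ _)
    _ = _ := by
        rw [Finset.sum_const, Finset.card_range, nsmul_eq_mul,
          ENNReal.ofReal_mul (p := (n + 1 : ℝ)) (by positivity), ← Nat.cast_succ,
          ENNReal.ofReal_natCast]

theorem measure_max_jump_le [IsProbabilityMeasure μ] (h : IsUrnProcess μ n p U hU)
    (hp0 : 0 ≤ p) (hp1 : p ≤ 1) (hn : 0 < n) {ε : ℝ} (hx : n * p < √(ε * n)) :
    μ {ω | ∃ i ∈ Finset.Icc 1 n,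
        ε ≤ (p * (U (i - 1) ω : ℝ) - ((U (i - 1) ω : ℝ) - (U i ω : ℝ))) ^ 2 / n} ≤
      ENNReal.ofReal
        (n * ((n + 1) * (Real.exp (n * p * Real.exp 1) * Real.exp (-√(ε * n))))) := by
  have hsub : {ω | ∃ i ∈ Finset.Icc 1 n,
        ε ≤ (p * (U (i - 1) ω : ℝ) - ((U (i - 1) ω : ℝ) - (U i ω : ℝ))) ^ 2 / n} ≤ᵐ[μ]
      ⋃ k ∈ Finset.range n, {ω | √(ε * n) ≤ (U k ω - U (k + 1) ω : ℕ)} := by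
    filter_upwards [ae_all_iff.2 h.ae_le, ae_all_iff.2 h.2.1] with ω h1 h2
    rintro ⟨i, hi, hε⟩
    obtain ⟨hi1, hin⟩ := Finset.mem_Icc.1 hi
    obtain ⟨k, rfl⟩ : ∃ k, i = k + 1 := ⟨i - 1, by omega⟩
    rw [Nat.add_sub_cancel, le_div_iff₀ (by positivity)] at hε
    refine Set.mem_biUnion (x := k) (by simpa using hin) ?_
    rw [Set.mem_ofPred_eq, Nat.cast_sub (h2 k)]
    have hUp : p * (U k ω : ℝ) ≤ n * p := by
      rw [mul_comm]
      gcongr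
      exact h1 k
    have hUp0 : 0 ≤ p * (U k ω : ℝ) := by positivity
    have hmono : (U (k + 1) ω : ℝ) ≤ U k ω := by exact_mod_cast h2 k
    rcases le_abs'.1 (Real.sqrt_le_sqrt hε |>.trans_eq (Real.sqrt_sq_eq_abs _)) with h3 | h3 <;> linarith
  refine (measure_mono_ae hsub).trans <| (measure_biUnion_finset_le _ _).trans ?_
  refine (Finset.sum_le_sum fun k _ => h.measure_le_decrement_le hp0 hp1 k _).trans_eq ?_
  rw [Finset.sum_const, Finset.card_range, nsmul_eq_mul, ENNReal.ofReal_mul (p := (n : ℝ))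
    (by positivity), ENNReal.ofReal_natCast]

end IsUrnProcess

theorem tendsto_mul_exp_neg_sqrt (K : ℝ) {ε : ℝ} (hε : 0 < ε) :
    Tendsto (fun n : ℕ => (n : ℝ) * ((n + 1) * (K * Real.exp (-√(ε * n))))) atTop (nhds 0) := by
  have hx : Tendsto (fun n : ℕ => √(ε * n)) atTop atTop :=
    Real.tendsto_sqrt_atTop.comp (tendsto_natCast_atTop_atTop.const_mul_atTop hε)
  have h4 := (Real.tendsto_pow_mul_exp_neg_atTop_nhds_zero 4).comp hx
  have h2 := (Real.tendsto_pow_mul_exp_neg_atTop_nhds_zero 2).comp hx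
  have h := (h4.const_mul (K / ε ^ 2)).add (h2.const_mul (K / ε))
  rw [mul_zero, mul_zero, add_zero] at h
  refine h.congr fun n => ?_
  have hs : √(ε * n) ^ 2 = ε * n := Real.sq_sqrt (by positivity)
  have hs4 : √(ε * n) ^ 4 = (ε * n) ^ 2 := by
    rw [show (4 : ℕ) = 2 * 2 from rfl, pow_mul, hs]
  simp only [Function.comp_apply, hs, hs4]
  field_simp

/-- Let `c > 0`.  For each `n`, let `U n` be an urn process with parameters
`n` and `p = c/n` (on a probability space `Ω n`), and let
`ν i = (c/n) U (i-1) - (U (i-1) - U i)` for `1 ≤ i ≤ n` be the centered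
increments.  Then for every `ε > 0`,
`P( max_{1 ≤ i ≤ n} ν i ² / n ≥ ε ) → 0` as `n → ∞`. -/
theorem urn_max_jump_negligible (c : ℝ) (hc : 0 < c)
    (Ω : ℕ → Type) (mΩ : ∀ n, MeasurableSpace (Ω n))
    (μ : ∀ n, Measure (Ω n)) (hμ : ∀ n, IsProbabilityMeasure (μ n))
    (U : ∀ n, ℕ → Ω n → ℕ) (hU : ∀ n i, StronglyMeasurable (U n i))
    (hurn : ∀ n : ℕ, c < (n : ℝ) → IsUrnProcess (μ n) n (c / n) (U n) (hU n)) :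
    ∀ ε : ℝ, 0 < ε →
      Filter.Tendsto
        (fun n : ℕ =>
          μ n {ω | ∃ i ∈ Finset.Icc 1 n,
            ε ≤ ((c / n) * (U n (i - 1) ω : ℝ) - ((U n (i - 1) ω : ℝ) - (U n i ω : ℝ))) ^ 2 / n})
        Filter.atTop (nhds 0) := by
  intro ε hε
  have hx : Tendsto (fun n : ℕ => √(ε * n)) atTop atTop :=
    Real.tendsto_sqrt_atTop.comp (tendsto_natCast_atTop_atTop.const_mul_atTop hε)
  have hlim := ENNReal.tendsto_ofReal (tendsto_mul_exp_neg_sqrt (Real.exp (c * Real.exp 1)) hε)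
  rw [ENNReal.ofReal_zero] at hlim
  refine tendsto_of_tendsto_of_tendsto_of_le_of_le' tendsto_const_nhds hlim
    (Eventually.of_forall fun _ => zero_le) ?_
  filter_upwards [hx.eventually_gt_atTop c,
    tendsto_natCast_atTop_atTop.eventually_gt_atTop c] with n hxn hcn
  have hn : (0 : ℝ) < n := hc.trans hcn
  have hnp : (n : ℝ) * (c / n) = c := mul_div_cancel₀ c hn.ne'
  have := (hurn n hcn).measure_max_jump_le (by positivity) ((div_le_one hn).2 hcn.le)
    (by exact_mod_cast hn) (ε := ε) (by rwa [hnp])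
  rwa [hnp] at this
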